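/- For all b > 0, x > 0, and 0 ≤ a < b, the principal value integral over t in (0, ∞) of cos(a t)·tan(b t)·t / (x² + t²) dt equals π·cosh(a x) / (e^{2 b x} + 1). -/

import Mathlib

open Real MeasureTheory Filter intervalIntegral

/-- `IsPVIntegral f p L` means the principal value of `∫₀^∞ f`, where `f` has
simple poles at the increasing sequence `p k`, equals `L`: for each sufficiently
small `ε > 0` one sums the integrals over the pole-free gaps (each pole shielded
by an `ε`-neighborhood), takes the limit over the number `N` of gaps, and this
value tends to `L` as `ε → 0⁺`. -/
def IsPVIntegral (f : ℝ → ℝ) (p : ℕ → ℝ) (L : ℝ) : Prop :=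
  ∃ ε₀ > (0:ℝ), ∃ F : ℝ → ℝ,
    (∀ ε ∈ Set.Ioo (0:ℝ) ε₀,
      Filter.Tendsto (fun N : ℕ =>
          (∫ t in (0:ℝ)..(p 0 - ε), f t) +
            ∑ k ∈ Finset.range N, ∫ t in (p k + ε)..(p (k + 1) - ε), f t)
        Filter.atTop (nhds (F ε))) ∧
    Filter.Tendsto F (nhdsWithin 0 (Set.Ioi 0)) (nhds L)

/-- The symmetric partial sum `∑_{|k| ≤ N} g (s + k c)`. -/
noncomputable def symmetricSum (c : ℝ) (g : ℝ → ℝ) (N : ℕ) (s : ℝ) : ℝ :=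
  g s + ∑ k ∈ Finset.range N, (g (s + c * (k + 1)) + g (s - c * (k + 1)))

theorem symmetricSum_zero (c : ℝ) (g : ℝ → ℝ) (s : ℝ) : symmetricSum c g 0 s = g s := by
  simp [symmetricSum]

theorem symmetricSum_succ (c : ℝ) (g : ℝ → ℝ) (N : ℕ) (s : ℝ) :
    symmetricSum c g (N + 1) s =
      symmetricSum c g N s + (g (s + c * (N + 1)) + g (s - c * (N + 1))) := by
  simp [symmetricSum, Finset.sum_range_succ, add_assoc]

theorem continuous_symmetricSum {c : ℝ} {g : ℝ → ℝ} (hg : Continuous g) (N : ℕ) :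
    Continuous (symmetricSum c g N) := by
  unfold symmetricSum
  fun_prop

theorem integral_cosh_mul_sin {x : ℝ} (hx : 0 < x) (a t : ℝ) :
    ∫ v in (0:ℝ)..a, Real.cosh (x * (a - v)) * Real.sin (v * t) =
      t * (Real.cosh (a * x) - Real.cos (a * t)) / (x ^ 2 + t ^ 2) := by
  have hne : x ^ 2 + t ^ 2 ≠ 0 := by positivity
  have hderiv : ∀ v ∈ Set.uIcc 0 a, HasDerivAt
      (fun v => -(t * (Real.cos (v * t) * Real.cosh (x * (a - v))) +
        x * (Real.sin (v * t) * Real.sinh (x * (a - v)))) / (x ^ 2 + t ^ 2))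
      (Real.cosh (x * (a - v)) * Real.sin (v * t)) v := by
    intro v _
    have h1 : HasDerivAt (fun v : ℝ => v * t) t v := by
      simpa using (hasDerivAt_id v).mul_const t
    have h2 : HasDerivAt (fun v : ℝ => x * (a - v)) (-x) v := by
      simpa using ((hasDerivAt_id v).const_sub a).const_mul x
    refine ((((h1.cos.mul h2.cosh).const_mul t).add
      ((h1.sin.mul h2.sinh).const_mul x)).neg.div_const (x ^ 2 + t ^ 2)).congr_deriv ?_
    rw [div_eq_iff hne]
    ring
  rw [integral_eq_sub_of_hasDerivAt hderiv
    (Continuous.intervalIntegrable (by fun_prop) _ _)]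
  simp [mul_comm x a]
  ring

theorem symmetricSum_sin_mul_sin (h v : ℝ) (N : ℕ) (s : ℝ) :
    symmetricSum (2 * h) (fun t => Real.sin (v * t)) N s * Real.sin (h * v) =
      Real.sin (v * s) * Real.sin ((2 * N + 1) * h * v) := by
  induction N with
  | zero => simp [symmetricSum_zero]
  | succ N ih =>
    rw [symmetricSum_succ, add_mul, ih]
    have e1 : v * (s + 2 * h * (N + 1)) = v * s + 2 * (N + 1) * h * v := by ring
    have e2 : v * (s - 2 * h * (N + 1)) = v * s - 2 * (N + 1) * h * v := by ring
    have e3 : (2 * (N : ℝ) + 1) * h * v = 2 * (N + 1) * h * v - h * v := by ring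
    have e4 : (2 * ((N + 1 : ℕ) : ℝ) + 1) * h * v = 2 * (N + 1) * h * v + h * v := by
      push_cast; ring
    rw [e1, e2, e3, e4]
    simp only [Real.sin_add, Real.sin_sub]
    ring

theorem symmetricSum_cos_mul_div {x : ℝ} (hx : 0 < x) (a c : ℝ) (N : ℕ) (s : ℝ) :
    symmetricSum c (fun t => Real.cos (a * t) * t / (x ^ 2 + t ^ 2)) N s =
      Real.cosh (a * x) * symmetricSum c (fun t => t / (x ^ 2 + t ^ 2)) N s -
        ∫ v in (0:ℝ)..a, Real.cosh (x * (a - v)) *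
          symmetricSum c (fun t => Real.sin (v * t)) N s := by
  have key : ∀ t, Real.cos (a * t) * t / (x ^ 2 + t ^ 2) =
      Real.cosh (a * x) * (t / (x ^ 2 + t ^ 2)) -
        ∫ v in (0:ℝ)..a, Real.cosh (x * (a - v)) * Real.sin (v * t) := by
    intro t
    rw [integral_cosh_mul_sin hx]
    ring
  have hint : ∀ t, IntervalIntegrable (fun v => Real.cosh (x * (a - v)) * Real.sin (v * t))
      volume 0 a := fun t => Continuous.intervalIntegrable (by fun_prop) _ _
  induction N with
  | zero => simpa only [symmetricSum_zero] using key s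
  | succ N ih =>
    have hsum : IntervalIntegrable (fun v => Real.cosh (x * (a - v)) *
        symmetricSum c (fun t => Real.sin (v * t)) N s) volume 0 a := by
      unfold symmetricSum
      exact Continuous.intervalIntegrable (by fun_prop) _ _
    simp only [symmetricSum_succ, ih]
    generalize s + c * (N + 1) = p, s - c * (N + 1) = q
    simp only [mul_add (Real.cosh _)]
    rw [integral_add hsum ((hint _).add (hint _)), integral_add (hint _) (hint _)]
    linear_combination key p + key q

theorem tendsto_intervalIntegral_mul_sin {w : ℝ → ℝ} {a b : ℝ}
    (hw : IntervalIntegrable w volume a b) :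
    Tendsto (fun r => ∫ v in a..b, w v * Real.sin (r * v)) atTop (nhds 0) := by
  wlog hab : a ≤ b generalizing a b
  · simpa [integral_symm a b] using (this hw.symm (le_of_not_ge hab)).neg
  rw [intervalIntegrable_iff_integrableOn_Ioc_of_le hab] at hw
  have hF : Integrable (fun v => (((Set.Ioc a b).indicator w v : ℝ) : ℂ)) :=
    ((integrable_indicator_iff measurableSet_Ioc).2 hw).ofReal
  have hRL := Real.tendsto_integral_exp_smul_cocompact
    (fun v => (((Set.Ioc a b).indicator w v : ℝ) : ℂ))
  have hr : Tendsto (fun r : ℝ => -(r / (2 * Real.pi))) atTop (cocompact ℝ) :=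
    (tendsto_neg_atTop_atBot.comp
      (tendsto_id.atTop_div_const Real.two_pi_pos)).mono_right atBot_le_cocompact
  have him := (Complex.continuous_im.tendsto 0).comp (hRL.comp hr)
  rw [Complex.zero_im] at him
  refine him.congr fun r => ?_
  have hint : Integrable fun v : ℝ =>
      Real.fourierChar (-(v * -(r / (2 * Real.pi)))) • (((Set.Ioc a b).indicator w v : ℝ) : ℂ) := by
    simpa [mul_comm] using (Real.fourierIntegral_convergent_iff (μ := volume) (-(r / (2 * Real.pi)))).2 hF
  have := integral_im hint
  simp only [RCLike.im_to_complex] at this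
  simp only [Function.comp_apply]
  rw [← this, integral_of_le hab, ← MeasureTheory.integral_indicator measurableSet_Ioc]
  refine integral_congr_ae (Eventually.of_forall fun v => ?_)
  have e : 2 * Real.pi * -(v * -(r / (2 * Real.pi))) = r * v := by
    field_simp
  by_cases hv : v ∈ Set.Ioc a b
  · simp only [Circle.smul_def, Real.fourierChar_apply, e, hv, Set.indicator_of_mem, smul_eq_mul,
      Complex.im_mul_ofReal, Complex.exp_ofReal_mul_I_im]
    ring
  · simp [hv]

theorem abs_sin_div_sin_le {h v s : ℝ} (hh : 0 < h) (hv : 0 < v) (hvh : h * v ≤ Real.pi / 2)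
    (hs : |s| ≤ h) : |Real.sin (v * s) / Real.sin (h * v)| ≤ Real.pi / 2 := by
  have hlow := Real.mul_le_sin (mul_pos hh hv).le hvh
  have hpos : 0 < 2 / Real.pi * (h * v) := by positivity
  rw [abs_div, abs_of_pos (hpos.trans_le hlow), div_le_iff₀ (hpos.trans_le hlow)]
  calc |Real.sin (v * s)| ≤ |v * s| := Real.abs_sin_le_abs
    _ ≤ v * h := by rw [abs_mul, abs_of_pos hv]; gcongr
    _ = Real.pi / 2 * (2 / Real.pi * (h * v)) := by field_simp
    _ ≤ _ := by gcongr

theorem integral_cosh_mul_symmetricSum {h a : ℝ} (hh : 0 < h) (ha : 0 ≤ a)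
    (hha : h * a < Real.pi / 2) (x s : ℝ) (N : ℕ) :
    ∫ v in (0:ℝ)..a, Real.cosh (x * (a - v)) *
        symmetricSum (2 * h) (fun t => Real.sin (v * t)) N s =
      ∫ v in (0:ℝ)..a, Real.cosh (x * (a - v)) * (Real.sin (v * s) / Real.sin (h * v)) *
        Real.sin ((2 * N + 1) * h * v) := by
  rw [integral_of_le ha, integral_of_le ha]
  refine setIntegral_congr_fun measurableSet_Ioc fun v hv => ?_
  have hsin : Real.sin (h * v) ≠ 0 :=
    (Real.sin_pos_of_pos_of_lt_pi (mul_pos hh hv.1)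
      (by nlinarith [hv.2, Real.pi_pos])).ne'
  rw [mul_assoc, div_mul_eq_mul_div, ← symmetricSum_sin_mul_sin, mul_div_cancel_right₀ _ hsin]

theorem abs_cosh_mul_sin_div_sin_le {h a x v s : ℝ} (hh : 0 < h) (hx : 0 < x)
    (hha : h * a < Real.pi / 2) (hs : |s| ≤ h) (hv : v ∈ Set.Ioc 0 a) :
    |Real.cosh (x * (a - v)) * (Real.sin (v * s) / Real.sin (h * v))| ≤
      Real.cosh (a * x) * (Real.pi / 2) := by
  rw [abs_mul, abs_of_pos (Real.cosh_pos _)]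
  gcongr
  · rw [Real.cosh_le_cosh, abs_of_nonneg (mul_nonneg hx.le (sub_nonneg.2 hv.2)),
      abs_of_nonneg (mul_nonneg (hv.1.le.trans hv.2) hx.le)]
    nlinarith [hv.1]
  · exact abs_sin_div_sin_le hh hv.1 (by nlinarith [hv.2]) hs

theorem tendsto_integral_cosh_mul_symmetricSum {h a x s : ℝ} (hh : 0 < h) (hx : 0 < x)
    (ha : 0 ≤ a) (hha : h * a < Real.pi / 2) (hs : |s| ≤ h) :
    Tendsto (fun N : ℕ => ∫ v in (0:ℝ)..a, Real.cosh (x * (a - v)) *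
      symmetricSum (2 * h) (fun t => Real.sin (v * t)) N s) atTop (nhds 0) := by
  simp only [integral_cosh_mul_symmetricSum hh ha hha]
  have hw : IntervalIntegrable
      (fun v => Real.cosh (x * (a - v)) * (Real.sin (v * s) / Real.sin (h * v))) volume 0 a := by
    rw [intervalIntegrable_iff_integrableOn_Ioc_of_le ha]
    refine Measure.integrableOn_of_bounded (M := Real.cosh (a * x) * (Real.pi / 2)) (by simp)
      (by fun_prop) ?_
    exact (ae_restrict_iff' measurableSet_Ioc).2 (Eventually.of_forall fun v hv =>
      abs_cosh_mul_sin_div_sin_le hh hx hha hs hv)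
  refine (tendsto_intervalIntegral_mul_sin hw).comp ?_
  refine Tendsto.atTop_mul_const hh (tendsto_atTop_add_const_right _ _ ?_)
  exact tendsto_natCast_atTop_atTop.const_mul_atTop two_pos

theorem abs_integral_cosh_mul_symmetricSum_le {h a x s : ℝ} (hh : 0 < h) (hx : 0 < x)
    (ha : 0 ≤ a) (hha : h * a < Real.pi / 2) (hs : |s| ≤ h) (N : ℕ) :
    |∫ v in (0:ℝ)..a, Real.cosh (x * (a - v)) *
      symmetricSum (2 * h) (fun t => Real.sin (v * t)) N s| ≤
      Real.cosh (a * x) * (Real.pi / 2) * a := by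
  rw [integral_cosh_mul_symmetricSum hh ha hha]
  have := norm_integral_le_of_norm_le_const (a := 0) (b := a)
    (C := Real.cosh (a * x) * (Real.pi / 2))
    (f := fun v => Real.cosh (x * (a - v)) * (Real.sin (v * s) / Real.sin (h * v)) *
        Real.sin ((2 * N + 1) * h * v)) fun v hv => by
      rw [Set.uIoc_of_le ha] at hv
      rw [norm_mul]
      exact (mul_le_of_le_one_right (norm_nonneg _) (Real.abs_sin_le_one _)).trans
        (abs_cosh_mul_sin_div_sin_le hh hx hha hs hv)
  simpa [abs_of_nonneg ha] using this

theorem abs_div_add_div_le {x s d : ℝ} (hx : 0 < x) (hd : 0 < d) (hs : 2 * |s| ≤ d) :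
    |(s + d) / (x ^ 2 + (s + d) ^ 2) + (s - d) / (x ^ 2 + (s - d) ^ 2)| ≤ 8 * |s| / d ^ 2 := by
  have key : ∀ s : ℝ, 0 ≤ s → 2 * s ≤ d →
      |(s + d) / (x ^ 2 + (s + d) ^ 2) + (s - d) / (x ^ 2 + (s - d) ^ 2)| ≤ 8 * s / d ^ 2 := by
    intro s h0 hsd
    have h1 : 0 < x ^ 2 + (s + d) ^ 2 := by positivity
    have h2 : 0 < x ^ 2 + (s - d) ^ 2 := by positivity
    have e : (s + d) / (x ^ 2 + (s + d) ^ 2) + (s - d) / (x ^ 2 + (s - d) ^ 2) =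
        2 * s / (x ^ 2 + (s - d) ^ 2) * ((x ^ 2 + s ^ 2 - d ^ 2) / (x ^ 2 + (s + d) ^ 2)) := by
      field_simp
      ring
    have hle : |(x ^ 2 + s ^ 2 - d ^ 2) / (x ^ 2 + (s + d) ^ 2)| ≤ 1 := by
      rw [abs_div, abs_of_pos h1, div_le_one h1, abs_le]
      constructor <;> nlinarith [sq_nonneg x, sq_nonneg s, mul_nonneg h0 hd.le, sq_nonneg d]
    rw [e, abs_mul, abs_of_nonneg (by positivity)]
    refine (mul_le_of_le_one_right (by positivity) hle).trans ?_
    rw [div_le_div_iff₀ h2 (by positivity)]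
    have : d ^ 2 ≤ 4 * (x ^ 2 + (s - d) ^ 2) := by nlinarith [sq_nonneg x]
    nlinarith
  rcases le_total 0 s with h0 | h0
  · rw [abs_of_nonneg h0] at hs ⊢
    exact key s h0 hs
  · rw [abs_of_nonpos h0] at hs ⊢
    convert key (-s) (neg_nonneg.2 h0) hs using 1
    rw [← abs_neg]
    congr 1
    rw [show (-s + d) ^ 2 = (s - d) ^ 2 by ring, show (-s - d) ^ 2 = (s + d) ^ 2 by ring]
    ring

theorem exists_abs_symmetricSum_le {h x : ℝ} (hh : 0 < h) (hx : 0 < x) :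
    ∃ C, ∀ (N : ℕ) (s : ℝ), |s| ≤ h →
      |symmetricSum (2 * h) (fun t => t / (x ^ 2 + t ^ 2)) N s| ≤ C := by
  have hsum : Summable fun k : ℕ => 2 / h * (1 / ((k : ℝ) + 1) ^ 2) := by
    have := (summable_nat_add_iff 1).2 (Real.summable_one_div_nat_pow.2 one_lt_two)
    exact Summable.mul_left _ (by exact_mod_cast this)
  refine ⟨h / x ^ 2 + ∑' k : ℕ, 2 / h * (1 / ((k : ℝ) + 1) ^ 2), fun N s hs => ?_⟩
  refine (abs_add_le _ _).trans (add_le_add ?_ ?_)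
  · rw [abs_div, abs_of_pos (by positivity : 0 < x ^ 2 + s ^ 2)]
    gcongr
    nlinarith [sq_nonneg s]
  · refine (Finset.abs_sum_le_sum_abs _ _).trans
      ((Finset.sum_le_sum fun k _ => ?_).trans (hsum.sum_le_tsum _ fun k _ => by positivity))
    have hk : (0 : ℝ) < k + 1 := by positivity
    refine (abs_div_add_div_le hx (by positivity) ?_).trans ?_
    · nlinarith [(Nat.cast_nonneg k : (0 : ℝ) ≤ k)]
    · calc 8 * |s| / (2 * h * (k + 1)) ^ 2 ≤ 8 * h / (2 * h * (k + 1)) ^ 2 := by gcongr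
        _ = 2 / h * (1 / ((k : ℝ) + 1) ^ 2) := by field_simp; norm_num

theorem re_one_div_mul_add_mul_I (r t x : ℝ) :
    (1 / ((r : ℂ) * (t + x * Complex.I))).re = r⁻¹ * (t / (x ^ 2 + t ^ 2)) := by
  rw [one_div, mul_inv, ← Complex.ofReal_inv, Complex.re_ofReal_mul, Complex.inv_re]
  simp [Complex.normSq_apply]
  left
  ring

theorem re_cot_add_mul_I (u y : ℝ) :
    (Complex.cot (u + y * Complex.I)).re =
      Real.sin u * Real.cos u / (Real.sinh y ^ 2 + Real.sin u ^ 2) := by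
  have hn : Complex.normSq (Complex.sin (u + y * Complex.I)) =
      Real.sinh y ^ 2 + Real.sin u ^ 2 := by
    rw [Complex.sin_add_mul_I, ← Complex.ofReal_sin, ← Complex.ofReal_cos, ← Complex.ofReal_cosh,
      ← Complex.ofReal_sinh, ← Complex.ofReal_mul, ← Complex.ofReal_mul, Complex.normSq_add_mul_I]
    nlinarith [Real.cosh_sq y, Real.sin_sq_add_cos_sq u]
  rw [Complex.cot, Complex.div_re, hn, Complex.sin_add_mul_I, Complex.cos_add_mul_I]
  simp only [← Complex.ofReal_sin, ← Complex.ofReal_cos, ← Complex.ofReal_cosh,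
      ← Complex.ofReal_sinh, ← Complex.ofReal_mul, Complex.add_re, Complex.sub_re, Complex.add_im,
      Complex.sub_im, Complex.ofReal_re, Complex.ofReal_im, Complex.re_ofReal_mul,
      Complex.im_ofReal_mul, Complex.I_re, Complex.I_im]
  rw [← add_div]
  congr 1
  linear_combination (Real.sin u * Real.cos u) * Real.cosh_sq y

theorem tendsto_symmetricSum_div {b x : ℝ} (hb : 0 < b) (hx : 0 < x) (s : ℝ) :
    Tendsto (fun N => symmetricSum (Real.pi / b) (fun t => t / (x ^ 2 + t ^ 2)) N s) atTop
      (nhds (b * (Real.sin (b * s) * Real.cos (b * s) /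
        (Real.sinh (b * x) ^ 2 + Real.sin (b * s) ^ 2)))) := by
  set z : ℂ := ((b / Real.pi : ℝ) : ℂ) * (s + x * Complex.I) with hz
  have him : z.im ≠ 0 := by
    have : z.im = b / Real.pi * x := by
      rw [hz, Complex.im_ofReal_mul]; simp
    rw [this]; positivity
  have hzmem : z ∈ Complex.integerComplement := by
    rintro ⟨n, hn⟩
    exact him (by rw [← hn]; simp)
  have hlim := (tendsto_logDeriv_euler_cot_sub hzmem).add_const (1 / z)
  rw [sub_add_cancel] at hlim
  have hre := ((Complex.continuous_re.tendsto _).comp hlim).const_mul (b / Real.pi)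
  have hpz : (Real.pi : ℂ) * z = ((b * s : ℝ) : ℂ) + ((b * x : ℝ) : ℂ) * Complex.I := by
    have : (Real.pi : ℂ) ≠ 0 := by exact_mod_cast Real.pi_ne_zero
    rw [hz]; push_cast; field_simp
  rw [hpz, Complex.re_ofReal_mul, re_cot_add_mul_I, ← mul_assoc,
    div_mul_cancel₀ _ Real.pi_ne_zero] at hre
  refine hre.congr fun N => ?_
  have hterm : ∀ t : ℝ, b / Real.pi * (1 / (((b / Real.pi : ℝ) : ℂ) * (t + x * Complex.I))).re =
      t / (x ^ 2 + t ^ 2) := by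
    intro t
    rw [re_one_div_mul_add_mul_I]
    field_simp
  have hsub : ∀ k : ℕ, z - (k + 1) = ((b / Real.pi : ℝ) : ℂ) *
      (((s - Real.pi / b * (k + 1) : ℝ) : ℂ) + x * Complex.I) := by
    intro k
    have h1 : (Real.pi : ℂ) ≠ 0 := by exact_mod_cast Real.pi_ne_zero
    have h2 : (b : ℂ) ≠ 0 := by exact_mod_cast hb.ne'
    rw [hz]; push_cast; field_simp; ring
  have hadd : ∀ k : ℕ, z + (k + 1) = ((b / Real.pi : ℝ) : ℂ) *
      (((s + Real.pi / b * (k + 1) : ℝ) : ℂ) + x * Complex.I) := by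
    intro k
    have h1 : (Real.pi : ℂ) ≠ 0 := by exact_mod_cast Real.pi_ne_zero
    have h2 : (b : ℂ) ≠ 0 := by exact_mod_cast hb.ne'
    rw [hz]; push_cast; field_simp; ring
  simp only [Function.comp_apply, Complex.add_re, Complex.re_sum, hsub, hadd, mul_add,
    Finset.mul_sum]
  simp only [← mul_add ((b / Real.pi : ℝ) : ℂ), hz, hterm]
  rw [add_comm]
  simp only [symmetricSum]
  congr 1
  exact Finset.sum_congr rfl fun k _ => by rw [mul_add (Real.pi / b), add_comm]

theorem integral_symmetric_add_eq {f : ℝ → ℝ} (hf : ∀ t, f (-t) = f t) {δ d : ℝ}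
    (hint : IntervalIntegrable (fun s => f (s + d)) volume (-δ) 0)
    (hint' : IntervalIntegrable (fun s => f (s + d)) volume 0 δ) :
    ∫ t in (d - δ)..(d + δ), f t = ∫ s in (0:ℝ)..δ, (f (s + d) + f (s - d)) := by
  have heven : ∀ s, f (-s + d) = f (s - d) := fun s => by
    rw [← hf, neg_add, neg_neg, sub_eq_add_neg]
  have hneg : IntervalIntegrable (fun s => f (s - d)) volume 0 δ := by
    have := ((IntervalIntegrable.iff_comp_neg).1 hint).symm
    simpa only [heven, neg_zero, neg_neg] using this
  rw [integral_add hint' hneg, show d - δ = -δ + d by ring, add_comm d δ,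
    ← integral_comp_add_right, ← integral_add_adjacent_intervals hint hint', add_comm]
  congr 1
  simp only [← heven, integral_comp_neg (fun s => f (s + d)), neg_zero]

theorem cos_mul_pos {b δ s : ℝ} (hb : 0 < b) (hδ : b * δ < Real.pi / 2)
    (hs : s ∈ Set.Icc (-δ) δ) : 0 < Real.cos (b * s) :=
  Real.cos_pos_of_mem_Ioo ⟨by nlinarith [hs.1], by nlinarith [hs.2]⟩

theorem continuousOn_tan_mul {b δ : ℝ} (hb : 0 < b) (hδ : b * δ < Real.pi / 2) :
    ContinuousOn (fun s => Real.tan (b * s)) (Set.Icc (-δ) δ) := by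
  simp only [Real.tan_eq_sin_div_cos]
  exact ContinuousOn.div (by fun_prop) (by fun_prop) fun s hs => (cos_mul_pos hb hδ hs).ne'

theorem integral_add_sum_gaps_eq {b ε : ℝ} (hb : 0 < b) (hε : ε ∈ Set.Ioo 0 (Real.pi / (2 * b)))
    {g : ℝ → ℝ} (hg : Continuous g) (hodd : ∀ t, g (-t) = -g t) (N : ℕ) :
    (∫ t in (0:ℝ)..((2 * ((0 : ℕ) : ℝ) + 1) * Real.pi / (2 * b) - ε), Real.tan (b * t) * g t) +
        ∑ k ∈ Finset.range N, ∫ t in ((2 * (k : ℝ) + 1) * Real.pi / (2 * b) + ε)..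
          ((2 * ((k + 1 : ℕ) : ℝ) + 1) * Real.pi / (2 * b) - ε), Real.tan (b * t) * g t =
      ∫ s in (0:ℝ)..(Real.pi / (2 * b) - ε),
        Real.tan (b * s) * symmetricSum (Real.pi / b) g N s := by
  set δ := Real.pi / (2 * b) - ε with hδdef
  have hδ0 : 0 < δ := sub_pos.2 hε.2
  have hδ : b * δ < Real.pi / 2 := by
    have : b * δ = Real.pi / 2 - b * ε := by rw [hδdef]; field_simp
    nlinarith [hε.1]
  have hev : ∀ t, Real.tan (b * -t) * g (-t) = Real.tan (b * t) * g t := by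
    intro t; rw [hodd, mul_neg b, Real.tan_neg]; ring
  have hcont := continuousOn_tan_mul hb hδ
  have hint : ∀ {u : ℝ → ℝ}, Continuous u → ∀ p ∈ Set.Icc (-δ) δ, ∀ q ∈ Set.Icc (-δ) δ,
      IntervalIntegrable (fun s => Real.tan (b * s) * u s) volume p q := by
    intro u hu p hp q hq
    exact ((hcont.mul hu.continuousOn).mono (Set.uIcc_subset_Icc hp hq)).intervalIntegrable
  have m0 : (0 : ℝ) ∈ Set.Icc (-δ) δ := ⟨by linarith, hδ0.le⟩
  have m1 : -δ ∈ Set.Icc (-δ) δ := ⟨le_rfl, by linarith⟩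
  have m2 : δ ∈ Set.Icc (-δ) δ := ⟨by linarith, le_rfl⟩
  induction N with
  | zero =>
    simp only [Finset.range_zero, Finset.sum_empty, add_zero, symmetricSum_zero]
    congr 1
    rw [hδdef]; simp
  | succ N ih =>
    have hadd : ∀ s, Real.tan (b * (s + Real.pi / b * (N + 1))) = Real.tan (b * s) := by
      intro s
      rw [show b * (s + Real.pi / b * (N + 1)) = b * s + (N + 1 : ℕ) * Real.pi by
        push_cast; field_simp, Real.tan_add_nat_mul_pi]
    have hgap : IntervalIntegrable (fun s => Real.tan (b * (s + Real.pi / b * (N + 1))) *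
        g (s + Real.pi / b * (N + 1))) volume (-δ) 0 := by
      simp only [hadd]
      exact hint (by fun_prop) _ m1 _ m0
    have hgap' : IntervalIntegrable (fun s => Real.tan (b * (s + Real.pi / b * (N + 1))) *
        g (s + Real.pi / b * (N + 1))) volume 0 δ := by
      simp only [hadd]
      exact hint (by fun_prop) _ m0 _ m2
    have e1 : (2 * (N : ℝ) + 1) * Real.pi / (2 * b) + ε = Real.pi / b * (N + 1) - δ := by
      rw [hδdef]; field_simp; ring
    have e2 : (2 * ((N + 1 : ℕ) : ℝ) + 1) * Real.pi / (2 * b) - ε =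
        Real.pi / b * (N + 1) + δ := by
      rw [hδdef]; push_cast; field_simp; ring
    have hsub : ∀ s, Real.tan (b * (s - Real.pi / b * (N + 1))) = Real.tan (b * s) := by
      intro s
      rw [show b * (s - Real.pi / b * (N + 1)) = b * s - (N + 1 : ℕ) * Real.pi by
        push_cast; field_simp, Real.tan_sub_nat_mul_pi]
    rw [Finset.sum_range_succ, ← add_assoc, ih, e1, e2,
      integral_symmetric_add_eq (f := fun t => Real.tan (b * t) * g t) hev hgap hgap',
      ← integral_add (hint (continuous_symmetricSum hg N) _ m0 _ m2) ?_]
    · simp only [symmetricSum_succ, hadd, hsub, mul_add (Real.tan _)]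
    · simp only [hadd, hsub, ← mul_add (Real.tan _)]
      exact hint (by fun_prop) _ m0 _ m2

theorem integral_tan_mul_cot_kernel {b x δ : ℝ} (hb : 0 < b) (hx : 0 < x) (hδ0 : 0 ≤ δ)
    (hδ : b * δ < Real.pi / 2) :
    ∫ s in (0:ℝ)..δ, Real.tan (b * s) * (b * (Real.sin (b * s) * Real.cos (b * s) /
        (Real.sinh (b * x) ^ 2 + Real.sin (b * s) ^ 2))) =
      b * δ - Real.tanh (b * x) *
        Real.arctan (Real.cosh (b * x) / Real.sinh (b * x) * Real.tan (b * δ)) := by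
  have hsinh : 0 < Real.sinh (b * x) := Real.sinh_pos_iff.2 (mul_pos hb hx)
  have hcosh := Real.cosh_pos (b * x)
  have hmem : ∀ s ∈ Set.uIcc 0 δ, s ∈ Set.Icc (-δ) δ := by
    intro s hs
    rw [Set.uIcc_of_le hδ0] at hs
    exact ⟨by linarith [hs.1], hs.2⟩
  have hderiv : ∀ s ∈ Set.uIcc 0 δ, HasDerivAt
      (fun s => b * s - Real.tanh (b * x) *
        Real.arctan (Real.cosh (b * x) / Real.sinh (b * x) * Real.tan (b * s)))
      (Real.tan (b * s) * (b * (Real.sin (b * s) * Real.cos (b * s) /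
        (Real.sinh (b * x) ^ 2 + Real.sin (b * s) ^ 2)))) s := by
    intro s hs
    have hcos := cos_mul_pos hb hδ (hmem s hs)
    have h1 : HasDerivAt (fun s : ℝ => b * s) b s := by
      simpa using (hasDerivAt_id s).const_mul b
    have h2 := (((Real.hasDerivAt_tan hcos.ne').comp s h1).const_mul
      (Real.cosh (b * x) / Real.sinh (b * x))).arctan.const_mul (Real.tanh (b * x))
    refine (h1.sub h2).congr_deriv ?_
    simp only [Function.comp_apply, Real.tan_eq_sin_div_cos, Real.tanh_eq_sinh_div_cosh]
    have hD : 0 < Real.sinh (b * x) ^ 2 + Real.sin (b * s) ^ 2 := by positivity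
    have hE : 1 + (Real.cosh (b * x) / Real.sinh (b * x) *
        (Real.sin (b * s) / Real.cos (b * s))) ^ 2 =
        (Real.sinh (b * x) ^ 2 + Real.sin (b * s) ^ 2) /
          (Real.sinh (b * x) ^ 2 * Real.cos (b * s) ^ 2) := by
      field_simp
      rw [Real.cosh_sq, Real.cos_sq']
      ring
    rw [hE]
    field_simp
    ring
  rw [integral_eq_sub_of_hasDerivAt hderiv]
  · simp
  · refine ContinuousOn.intervalIntegrable (ContinuousOn.mul
      ((continuousOn_tan_mul hb hδ).mono hmem) (Continuous.continuousOn ?_))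
    exact continuous_const.mul (Continuous.div (by fun_prop) (by fun_prop)
      fun s => by positivity)

theorem tendsto_integral_tan_mul_symmetricSum {a b x δ : ℝ} (hb : 0 < b) (hx : 0 < x)
    (ha : 0 ≤ a) (hab : a < b) (hδ0 : 0 ≤ δ) (hδ : b * δ < Real.pi / 2) :
    Tendsto (fun N => ∫ s in (0:ℝ)..δ, Real.tan (b * s) *
        symmetricSum (Real.pi / b) (fun t => Real.cos (a * t) * t / (x ^ 2 + t ^ 2)) N s) atTop
      (nhds (Real.cosh (a * x) * (b * δ - Real.tanh (b * x) *
        Real.arctan (Real.cosh (b * x) / Real.sinh (b * x) * Real.tan (b * δ))))) := by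
  set h := Real.pi / (2 * b) with hh_def
  have hh : 0 < h := by positivity
  have hc : Real.pi / b = 2 * h := by rw [hh_def]; field_simp
  have hha : h * a < Real.pi / 2 := by
    calc h * a < h * b := by gcongr
      _ = Real.pi / 2 := by rw [hh_def]; field_simp
  have hδh : δ ≤ h := by
    rw [hh_def, le_div_iff₀ (by positivity)]
    linarith
  obtain ⟨C, hC⟩ := exists_abs_symmetricSum_le hh hx
  have hmem : ∀ s ∈ Set.uIoc 0 δ, |s| ≤ h := by
    intro s hs
    rw [Set.uIoc_of_le hδ0] at hs
    rw [abs_of_pos hs.1]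
    exact hs.2.trans hδh
  have hsub : Set.uIcc 0 δ ⊆ Set.Icc (-δ) δ := by
    rw [Set.uIcc_of_le hδ0]
    exact Set.Icc_subset_Icc_left (by linarith)
  have hcont := (continuousOn_tan_mul hb hδ).mono hsub
  rw [← integral_tan_mul_cot_kernel hb hx hδ0 hδ, ← intervalIntegral.integral_const_mul]
  refine intervalIntegral.tendsto_integral_filter_of_dominated_convergence
    (fun s => |Real.tan (b * s)| * (Real.cosh (a * x) * C +
      Real.cosh (a * x) * (Real.pi / 2) * a)) (Eventually.of_forall fun N => ?_)
    (Eventually.of_forall fun N => Eventually.of_forall fun s hs => ?_) ?_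
    (Eventually.of_forall fun s hs => ?_)
  · refine ContinuousOn.aestronglyMeasurable ?_ measurableSet_uIoc
    refine (hcont.mono Set.uIoc_subset_uIcc).mul (continuous_symmetricSum ?_ N).continuousOn
    exact Continuous.div (by fun_prop) (by fun_prop) fun t => by positivity
  · rw [symmetricSum_cos_mul_div hx, norm_mul, Real.norm_eq_abs, hc]
    refine mul_le_mul_of_nonneg_left ((norm_sub_le _ _).trans (add_le_add ?_ ?_)) (abs_nonneg _)
    · rw [norm_mul, Real.norm_of_nonneg (Real.cosh_pos _).le]
      exact mul_le_mul_of_nonneg_left (hC N s (hmem s hs)) (Real.cosh_pos _).le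
    · exact abs_integral_cosh_mul_symmetricSum_le hh hx ha hha (hmem s hs) N
  · exact (hcont.abs.mul continuousOn_const).intervalIntegrable
  · simp only [symmetricSum_cos_mul_div hx]
    have h1 := (tendsto_symmetricSum_div hb hx s).const_mul (Real.cosh (a * x))
    have h2 := tendsto_integral_cosh_mul_symmetricSum hh hx ha hha (hmem s hs)
    rw [← hc] at h2
    have h3 := (h1.sub h2).const_mul (Real.tan (b * s))
    convert h3 using 2
    ring

theorem one_sub_tanh (y : ℝ) : 1 - Real.tanh y = 2 / (Real.exp (2 * y) + 1) := by
  have h1 := Real.cosh_pos y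
  have h2 := Real.exp_pos y
  rw [Real.tanh_eq_sinh_div_cosh, one_sub_div h1.ne', Real.cosh_sub_sinh, Real.cosh_eq, two_mul,
    Real.exp_add, Real.exp_neg]
  field_simp

theorem pv_cos_tan (a b x : ℝ) (hb : 0 < b) (hx : 0 < x) (ha : 0 ≤ a) (hab : a < b) :
    IsPVIntegral (fun t => Real.cos (a * t) * Real.tan (b * t) * t / (x ^ 2 + t ^ 2)) (fun k => (2 * (k : ℝ) + 1) * Real.pi / (2 * b)) (Real.pi * Real.cosh (a * x) / (Real.exp (2 * b * x) + 1)) := by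
  refine ⟨Real.pi / (2 * b), by positivity, fun ε => Real.cosh (a * x) *
    (b * (Real.pi / (2 * b) - ε) - Real.tanh (b * x) * Real.arctan
      (Real.cosh (b * x) / Real.sinh (b * x) * Real.tan (b * (Real.pi / (2 * b) - ε)))),
    fun ε hε => ?_, ?_⟩
  · have hδ : b * (Real.pi / (2 * b) - ε) < Real.pi / 2 := by
      have : b * (Real.pi / (2 * b) - ε) = Real.pi / 2 - b * ε := by field_simp
      nlinarith [hε.1]
    refine (tendsto_integral_tan_mul_symmetricSum hb hx ha hab (sub_pos.2 hε.2).le hδ).congr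
      fun N => ?_
    rw [← integral_add_sum_gaps_eq (g := fun t => Real.cos (a * t) * t / (x ^ 2 + t ^ 2)) hb hε
      (Continuous.div (by fun_prop) (by fun_prop) fun t => by positivity)
      (fun t => by rw [mul_neg a, Real.cos_neg]; ring)]
    have e : ∀ t, Real.cos (a * t) * Real.tan (b * t) * t / (x ^ 2 + t ^ 2) =
        Real.tan (b * t) * (Real.cos (a * t) * t / (x ^ 2 + t ^ 2)) := fun t => by ring
    simp only [e]
  · have hsinh : 0 < Real.sinh (b * x) := Real.sinh_pos_iff.2 (mul_pos hb hx)
    have hcosh := Real.cosh_pos (b * x)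
    have hlin : Tendsto (fun ε => b * (Real.pi / (2 * b) - ε)) (nhdsWithin 0 (Set.Ioi 0))
        (nhds (Real.pi / 2)) := by
      have : Continuous fun ε => b * (Real.pi / (2 * b) - ε) := by fun_prop
      convert (this.tendsto 0).mono_left nhdsWithin_le_nhds using 2
      field_simp
      simp
    have hlt : Tendsto (fun ε => b * (Real.pi / (2 * b) - ε)) (nhdsWithin 0 (Set.Ioi 0))
        (nhdsWithin (Real.pi / 2) (Set.Iio (Real.pi / 2))) := by
      refine tendsto_nhdsWithin_iff.2 ⟨hlin, ?_⟩
      filter_upwards [self_mem_nhdsWithin] with ε hε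
      have : b * (Real.pi / (2 * b) - ε) = Real.pi / 2 - b * ε := by field_simp
      rw [Set.mem_Iio, this]
      linarith [mul_pos hb hε]
    have harctan := (Real.tendsto_arctan_atTop.mono_right nhdsWithin_le_nhds).comp
      ((Real.tendsto_tan_pi_div_two.comp hlt).const_mul_atTop (div_pos hcosh hsinh))
    have hmain := (hlin.sub (harctan.const_mul (Real.tanh (b * x)))).const_mul (Real.cosh (a * x))
    have htanh := one_sub_tanh (b * x)
    rw [← mul_assoc] at htanh
    rwa [show Real.cosh (a * x) * (Real.pi / 2 - Real.tanh (b * x) * (Real.pi / 2)) =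
        Real.pi * Real.cosh (a * x) / (Real.exp (2 * b * x) + 1) by
      linear_combination (Real.cosh (a * x) * Real.pi / 2) * htanh] at hmain
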